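/- arXiv:1911.01374 — 5 statements merged into one kernel-verified Lean document; each statement's English description precedes it below -/
import Mathlib

section
/- Let t, N, M ≥ 1 be integers. For i = 1, …, N let R_i = r_i^1 ∪ … ∪ r_i^t be a red t-object with constituents r_i^s ⊆ α, and for j = 1, …, M let B_j = b_j^1 ∪ … ∪ b_j^t be a blue t-object with constituents b_j^s ⊆ α. Let w_1, …, w_N be nonnegative weights and let x ∈ [0,1]^N satisfy ∑_{i : R_i ∩ B_j ≠ ∅} x_i ≥ 1 for every j. Define x'_i = min(t · x_i, 1). Then there exists, for each j, a constituent b'_j ∈ {b_j^1, …, b_j^t} such that ∑_{i : R_i ∩ b'_j ≠ ∅} x'_i ≥ 1 for every j; moreover ∑_{i=1}^N w_i x'_i ≤ t · ∑_{i=1}^N w_i x_i. -/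
open scoped Classical

/-- Observation 1 of the paper: if `x ∈ [0,1]^N` is feasible for the
instance with blue `t`-objects `B_j = b_j^1 ∪ … ∪ b_j^t`, then the scaled solution
`x'_i = min(t·x_i, 1)` is feasible for the instance where each `B_j` is replaced by a
suitably chosen constituent, and its cost is at most `t` times the cost of `x`. -/
theorem scaled_solution_feasible {α : Type*} (t N M : ℕ) (ht : 1 ≤ t) (hN : 1 ≤ N)
    (hM : 1 ≤ M)
    (r : Fin N → Fin t → Set α) (b : Fin M → Fin t → Set α)
    (R : Fin N → Set α) (hR : ∀ i, R i = ⋃ s, r i s)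
    (B : Fin M → Set α) (hB : ∀ j, B j = ⋃ s, b j s)
    (w : Fin N → ℝ) (hw : ∀ i, 0 ≤ w i)
    (x : Fin N → ℝ) (hx : ∀ i, 0 ≤ x i ∧ x i ≤ 1)
    (hfeas : ∀ j, 1 ≤ ∑ i ∈ Finset.univ.filter (fun i => (R i ∩ B j).Nonempty), x i)
    (x' : Fin N → ℝ) (hx' : ∀ i, x' i = min ((t : ℝ) * x i) 1) :
    (∃ c : Fin M → Fin t, ∀ j,
        1 ≤ ∑ i ∈ Finset.univ.filter (fun i => (R i ∩ b j (c j)).Nonempty), x' i) ∧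
      ∑ i, w i * x' i ≤ (t : ℝ) * ∑ i, w i * x i := by
  have hx0 : ∀ i, 0 ≤ x' i := fun i => by
    rw [hx']
    exact le_min (mul_nonneg (Nat.cast_nonneg t) (hx i).1) zero_le_one
  constructor
  · have key : ∀ j, ∃ s : Fin t,
        1 ≤ ∑ i ∈ Finset.univ.filter (fun i => (R i ∩ b j s).Nonempty), x' i := by
      intro j
      by_contra hcon
      have hlt : ∀ s : Fin t,
          ∑ i ∈ Finset.univ.filter (fun i => (R i ∩ b j s).Nonempty), x' i < 1 :=
        fun s => lt_of_not_ge fun h => hcon ⟨s, h⟩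
      have heq : ∀ s : Fin t,
          (t : ℝ) * ∑ i ∈ Finset.univ.filter (fun i => (R i ∩ b j s).Nonempty), x i < 1 := by
        intro s
        refine lt_of_eq_of_lt ?_ (hlt s)
        rw [Finset.mul_sum]
        refine Finset.sum_congr rfl fun i hi => ?_
        have h1 : x' i < 1 :=
          lt_of_le_of_lt (Finset.single_le_sum (fun k _ => hx0 k) hi) (hlt s)
        rw [hx'] at h1 ⊢
        rcases min_lt_iff.1 h1 with h | h
        · exact (min_eq_left h.le).symm
        · exact absurd h (lt_irrefl _)
      have hsub : Finset.univ.filter (fun i => (R i ∩ B j).Nonempty) ⊆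
          Finset.univ.biUnion
            (fun s : Fin t => Finset.univ.filter (fun i => (R i ∩ b j s).Nonempty)) := by
        intro i hi
        obtain ⟨a, ha, hb⟩ := (Finset.mem_filter.1 hi).2
        rw [hB] at hb
        obtain ⟨s, hs⟩ := Set.mem_iUnion.1 hb
        exact Finset.mem_biUnion.2
          ⟨s, Finset.mem_univ _, Finset.mem_filter.2 ⟨Finset.mem_univ _, a, ha, hs⟩⟩
      have h1 : (1 : ℝ) ≤ ∑ s : Fin t,
          ∑ i ∈ Finset.univ.filter (fun i => (R i ∩ b j s).Nonempty), x i := by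
        refine (hfeas j).trans ((Finset.sum_le_sum_of_subset_of_nonneg hsub
          fun i _ _ => (hx i).1).trans ?_)
        simp only [Finset.sum_filter]
        rw [Finset.sum_comm]
        rw [← Finset.sum_subset (Finset.subset_univ (Finset.univ.biUnion
            (fun s : Fin t => Finset.univ.filter (fun i => (R i ∩ b j s).Nonempty))))]
        · refine Finset.sum_le_sum fun i hi => ?_
          obtain ⟨s, _, hs⟩ := Finset.mem_biUnion.1 hi
          have hs' := (Finset.mem_filter.1 hs).2
          have := Finset.single_le_sum
            (f := fun s : Fin t => if (R i ∩ b j s).Nonempty then x i else 0)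
            (fun k _ => by
              show (0 : ℝ) ≤ if (R i ∩ b j k).Nonempty then x i else 0
              split_ifs
              · exact (hx i).1
              · exact le_rfl) (Finset.mem_univ s)
          simpa only [if_pos hs'] using this
        · intro i _ hi
          refine Finset.sum_eq_zero fun s _ => if_neg fun h => hi ?_
          exact Finset.mem_biUnion.2
            ⟨s, Finset.mem_univ _, Finset.mem_filter.2 ⟨Finset.mem_univ _, h⟩⟩
      have h2 : ∑ s : Fin t, (t : ℝ) *
          ∑ i ∈ Finset.univ.filter (fun i => (R i ∩ b j s).Nonempty), x i
          < ∑ _s : Fin t, (1 : ℝ) :=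
        Finset.sum_lt_sum_of_nonempty ⟨⟨0, ht⟩, Finset.mem_univ _⟩ fun s _ => heq s
      rw [← Finset.mul_sum] at h2
      simp only [Finset.sum_const, Finset.card_univ, Fintype.card_fin, nsmul_eq_mul,
        mul_one] at h2
      have h3 := mul_le_mul_of_nonneg_left h1 (Nat.cast_nonneg (α := ℝ) t)
      linarith
    choose c hc using key
    exact ⟨c, hc⟩
  · rw [Finset.mul_sum]
    refine Finset.sum_le_sum fun i _ => ?_
    have h : x' i ≤ t * x i := by
      rw [hx']
      exact min_le_left _ _
    have := mul_le_mul_of_nonneg_left h (hw i)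
    linarith
end

section
/- Let t, N, M ≥ 1 be integers, let r_i^s ⊆ α for i ∈ {1, …, N} and s ∈ {1, …, t} be constituents, let R_i = r_i^1 ∪ … ∪ r_i^t, and let B'_1, …, B'_M ⊆ α. For a subset S ⊆ {1, …, N} of columns, the row of the t-object incidence matrix associated with j ∈ {1, …, M} is the 0/1 vector (1[B'_j ∩ R_i ≠ ∅])_{i ∈ S}; for a subset S' of constituent indices, the row of the constituent incidence matrix associated with j is the 0/1 vector (1[B'_j ∩ r_i^s ≠ ∅])_{(i,s) ∈ S'}. Let f : ℕ × ℕ → ℕ be nondecreasing in its first argument, and suppose that for all integers 1 ≤ k ≤ n ≤ Nt and every set S' of n constituent indices, the number of distinct rows of the constituent incidence matrix restricted to S' having at most k ones is at most f(n, k). Then for all integers 1 ≤ k ≤ n ≤ N and every set S ⊆ {1, …, N} with |S| = n, the number of distinct rows of the t-object incidence matrix restricted to S having at most k ones is at most f(nt, kt). -/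
open scoped Classical

/-- Lemma 3 of the paper: if the constituent incidence instance has
shallow-cell complexity `f` (nondecreasing in its first argument), then for any `n`
columns of the `t`-object incidence matrix, the number of distinct rows with at most
`k` ones is at most `f (n*t) (k*t)`.

A row of the `t`-object matrix restricted to `S ⊆ Fin N` is encoded as the 0/1 vector
`fun i => if i ∈ S ∧ (B' j ∩ R i).Nonempty then 1 else 0`; its number of ones is
`∑ i, v i`. Rows of the constituent matrix restricted to `S' ⊆ Fin N × Fin t` are
encoded analogously. -/
theorem scc_transfer {α : Type*} (t N M : ℕ) (ht : 1 ≤ t) (hN : 1 ≤ N) (hM : 1 ≤ M)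
    (r : Fin N → Fin t → Set α) (R : Fin N → Set α) (hR : ∀ i, R i = ⋃ s, r i s)
    (B' : Fin M → Set α)
    (f : ℕ → ℕ → ℕ) (hf : ∀ k, Monotone fun n => f n k)
    (hcon : ∀ n k : ℕ, 1 ≤ k → k ≤ n → n ≤ N * t →
      ∀ S' : Finset (Fin N × Fin t), S'.card = n →
        ((Finset.univ.image fun j : Fin M =>
            fun p : Fin N × Fin t =>
              if p ∈ S' ∧ (B' j ∩ r p.1 p.2).Nonempty then (1 : ℕ) else 0).filter
          fun v => ∑ p, v p ≤ k).card ≤ f n k) :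
    ∀ n k : ℕ, 1 ≤ k → k ≤ n → n ≤ N →
      ∀ S : Finset (Fin N), S.card = n →
        ((Finset.univ.image fun j : Fin M =>
            fun i : Fin N =>
              if i ∈ S ∧ (B' j ∩ R i).Nonempty then (1 : ℕ) else 0).filter
          fun v => ∑ i, v i ≤ k).card ≤ f (n * t) (k * t) := by
  intro n k hk hkn hnN S hS
  have key := hcon (n * t) (k * t) (Nat.mul_pos hk ht) (Nat.mul_le_mul_right t hkn)
    (Nat.mul_le_mul_right t hnN) (S ×ˢ Finset.univ) (by simp [hS])
  refine le_trans ?_ key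
  let φ : (Fin N × Fin t → ℕ) → (Fin N → ℕ) := fun w i => if ∃ s, w (i, s) = 1 then 1 else 0
  refine le_trans (Finset.card_le_card ?_) (Finset.card_image_le (f := φ))
  intro v hv
  obtain ⟨hv, hsum⟩ := Finset.mem_filter.1 hv
  obtain ⟨j, -, rfl⟩ := Finset.mem_image.1 hv
  have hne : ∀ i, (B' j ∩ R i).Nonempty ↔ ∃ s, (B' j ∩ r i s).Nonempty := by
    intro i
    rw [hR, Set.inter_iUnion, Set.nonempty_iUnion]
  refine Finset.mem_image.2 ⟨_, Finset.mem_filter.2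
    ⟨Finset.mem_image.2 ⟨j, Finset.mem_univ _, rfl⟩, ?_⟩, ?_⟩
  · refine le_trans ?_ (Nat.mul_le_mul_right t hsum)
    rw [Fintype.sum_prod_type, Finset.sum_mul]
    refine Finset.sum_le_sum fun i _ => ?_
    refine le_trans (Finset.sum_le_card_nsmul _ _
      (if i ∈ S ∧ (B' j ∩ R i).Nonempty then 1 else 0) ?_) ?_
    · intro s _
      by_cases h : i ∈ S ∧ (B' j ∩ r i s).Nonempty
      · have h2 : i ∈ S ∧ (B' j ∩ R i).Nonempty := ⟨h.1, (hne i).2 ⟨s, h.2⟩⟩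
        simp [h, h2]
      · simp [h]
    · simp [mul_comm]
  · funext i
    simp only [φ, hne]
    by_cases h : i ∈ S <;> simp [h]
end

section
/- Let B_1, …, B_M be nonempty closed bounded intervals B_j = [l_j, u_j] in ℝ such that for all j ≠ k one has B_j ⊄ B_k (no blue interval is contained in another), and suppose the intervals are indexed so that l_1 ≤ l_2 ≤ … ≤ l_M. Then for every nonempty closed bounded interval R = [a, b] in ℝ and all indices j ≤ ℓ ≤ k, if R ∩ B_j ≠ ∅ and R ∩ B_k ≠ ∅, then R ∩ B_ℓ ≠ ∅. -/
/-- consecutive ones property: if `B_j = [l_j, u_j]` are nonempty closed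
intervals, none strictly contained in another, sorted by nondecreasing left endpoint,
then for any nonempty interval `R = [a,b]` and indices `j ≤ ℓ ≤ k`, if `R` meets `B_j`
and `B_k` then `R` meets `B_ℓ`. -/
theorem consecutive_ones (M : ℕ) (l u : Fin M → ℝ) (hne : ∀ j, l j ≤ u j)
    (hnc : ∀ j k : Fin M, j ≠ k →
      ¬ (Set.Icc (l j) (u j) ⊂ Set.Icc (l k) (u k)))
    (hsort : Monotone l)
    (a b : ℝ) (hab : a ≤ b)
    (j ℓ k : Fin M) (hjl : j ≤ ℓ) (hlk : ℓ ≤ k)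
    (hj : (Set.Icc a b ∩ Set.Icc (l j) (u j)).Nonempty)
    (hk : (Set.Icc a b ∩ Set.Icc (l k) (u k)).Nonempty) :
    (Set.Icc a b ∩ Set.Icc (l ℓ) (u ℓ)).Nonempty := by
  obtain ⟨x, ⟨hx1, hx2⟩, hx3, hx4⟩ := hj
  obtain ⟨y, ⟨hy1, hy2⟩, hy3, hy4⟩ := hk
  have h1 := hsort hjl
  have h2 := hsort hlk
  have hu : u j ≤ u ℓ := by
    by_contra hlt
    have hlt := not_le.mp hlt
    have hjn : ℓ ≠ j := by
      rintro rfl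
      exact lt_irrefl _ hlt
    refine hnc ℓ j hjn ⟨Set.Icc_subset_Icc h1 hlt.le, fun hs => ?_⟩
    exact absurd (hs (Set.right_mem_Icc.mpr (hne j))).2 (not_le.mpr hlt)
  exact ⟨max a (l ℓ), ⟨le_max_left _ _, max_le hab (by linarith)⟩,
    le_max_right _ _, max_le (by linarith) (hne ℓ)⟩
end

section
/- Let R_1, …, R_N and B_1, …, B_M be nonempty closed bounded intervals in ℝ. Let P = { x ∈ ℝ^N : 0 ≤ x_i ≤ 1 for all i, and ∑_{i : R_i ∩ B_j ≠ ∅} x_i ≥ 1 for all j }. Then every extreme point of the convex set P has all coordinates in {0, 1}. -/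
open scoped Classical

/-- Contribution of edge `(a,b)` with value `t` to the divergence at `v`. -/
noncomputable def edgeDiv (a b v : ℕ) (t : ℝ) : ℝ :=
  (if a = v then t else 0) - (if b = v then t else 0)

lemma circ_exists {α : Type} [Fintype α] (l r : α → ℕ) (x : α → ℝ) (Z : AddSubgroup ℝ)
    (hx : ∀ v, ∑ i, edgeDiv (l i) (r i) v (x i) ∈ Z) (i0 : α) (hi0 : x i0 ∉ Z) :
    ∃ y : α → ℝ, y ≠ 0 ∧ (∀ i, x i ∈ Z → y i = 0) ∧
      ∀ v, ∑ i, edgeDiv (l i) (r i) v (y i) = 0 := by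
  by_cases hloop : ∃ i, x i ∉ Z ∧ l i = r i
  · obtain ⟨i, hi, hlr⟩ := hloop
    refine ⟨Pi.single i 1, ?_, ?_, ?_⟩
    · intro h
      have := congrFun h i
      simp at this
    · intro k hk
      have : k ≠ i := by rintro rfl; exact hi hk
      simp [this]
    · intro v
      apply Finset.sum_eq_zero
      intro k _
      by_cases hk : k = i
      · subst hk; simp [edgeDiv, hlr]
      · simp [edgeDiv, hk]
  push Not at hloop
  let F : Finset α := Finset.univ.filter (fun i => x i ∉ Z)
  let V : Finset ℕ := F.image l ∪ F.image r
  have memF : ∀ i, i ∈ F ↔ x i ∉ Z := fun i => by simp [F]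
  have lV : ∀ i ∈ F, l i ∈ V := fun i hi =>
    Finset.mem_union_left _ (Finset.mem_image_of_mem _ hi)
  have rV : ∀ i ∈ F, r i ∈ V := fun i hi =>
    Finset.mem_union_right _ (Finset.mem_image_of_mem _ hi)
  have hdeg : ∀ v ∈ V, 2 ≤ (F.filter (fun i => l i = v ∨ r i = v)).card := by
    intro v hv
    have hne : ∃ i ∈ F, l i = v ∨ r i = v := by
      simp only [V, Finset.mem_union, Finset.mem_image] at hv
      rcases hv with ⟨i, hi, h⟩ | ⟨i, hi, h⟩
      · exact ⟨i, hi, Or.inl h⟩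
      · exact ⟨i, hi, Or.inr h⟩
    obtain ⟨i, hi, hiv⟩ := hne
    by_contra hlt
    have huniq : ∀ k ∈ F, (l k = v ∨ r k = v) → k = i := by
      intro k hk hkv
      have hle : (F.filter (fun i => l i = v ∨ r i = v)).card ≤ 1 := by omega
      exact Finset.card_le_one.1 hle k (Finset.mem_filter.2 ⟨hk, hkv⟩) i
        (Finset.mem_filter.2 ⟨hi, hiv⟩)
    have h1 := hx v
    rw [← Finset.add_sum_erase _ _ (Finset.mem_univ i)] at h1
    have h2 : ∑ k ∈ Finset.univ.erase i, edgeDiv (l k) (r k) v (x k) ∈ Z := by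
      apply Z.sum_mem
      intro k hk
      have hki : k ≠ i := (Finset.mem_erase.1 hk).1
      by_cases hkF : k ∈ F
      · have := not_or.1 (fun h => hki (huniq k hkF h))
        simp [edgeDiv, this.1, this.2, Z.zero_mem]
      · rw [memF, not_not] at hkF
        unfold edgeDiv
        apply Z.sub_mem <;> split_ifs <;> simp [hkF, Z.zero_mem]
    have h3 := (Z.add_mem_cancel_right h2).1 h1
    have hlr := hloop i ((memF i).1 hi)
    apply (memF i).1 hi
    unfold edgeDiv at h3
    rcases hiv with h | h
    · have : r i ≠ v := fun h' => hlr (h.trans h'.symm)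
      simpa [h, this] using h3
    · have : l i ≠ v := fun h' => hlr (h'.trans h.symm)
      simpa [h, this] using h3
  have hcard : V.card ≤ F.card := by
    have h1 : ∑ v ∈ V, (F.filter (fun i => l i = v ∨ r i = v)).card
        = ∑ i ∈ F, (V.filter (fun v => l i = v ∨ r i = v)).card :=
      Finset.sum_card_bipartiteAbove_eq_sum_card_bipartiteBelow (fun v i => l i = v ∨ r i = v)
    have h2 : V.card * 2 ≤ ∑ v ∈ V, (F.filter (fun i => l i = v ∨ r i = v)).card := by
      simpa using Finset.card_nsmul_le_sum V _ 2 hdeg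
    have h3 : ∑ i ∈ F, (V.filter (fun v => l i = v ∨ r i = v)).card ≤ F.card * 2 := by
      rw [← smul_eq_mul]
      apply Finset.sum_le_card_nsmul
      intro i _
      refine (Finset.card_le_card (t := {l i, r i}) ?_).trans Finset.card_le_two
      intro v hv
      have := (Finset.mem_filter.1 hv).2
      simp only [Finset.mem_insert, Finset.mem_singleton]
      tauto
    omega
  let L : (α → ℝ) →ₗ[ℝ] (({v // v ∈ V} ⊕ {i // i ∉ F}) → ℝ) :=
    { toFun := fun y s => Sum.elim
        (fun v => ∑ i, edgeDiv (l i) (r i) v.1 (y i)) (fun i => y i.1) s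
      map_add' := by
        intro y z
        ext s
        rcases s with v | i
        · simp only [Sum.elim_inl, Pi.add_apply, ← Finset.sum_add_distrib]
          apply Finset.sum_congr rfl
          intro i _
          unfold edgeDiv
          split_ifs <;> ring
        · simp
      map_smul' := by
        intro c y
        ext s
        rcases s with v | i
        · simp only [Sum.elim_inl, Pi.smul_apply, smul_eq_mul, Finset.mul_sum, RingHom.id_apply]
          apply Finset.sum_congr rfl
          intro i _
          unfold edgeDiv
          split_ifs <;> ring
        · simp }
  have hLinl : ∀ y (v : {v // v ∈ V}), L y (Sum.inl v) = ∑ i, edgeDiv (l i) (r i) v.1 (y i) :=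
    fun _ _ => rfl
  have hLinr : ∀ y (i : {i // i ∉ F}), L y (Sum.inr i) = y i.1 := fun _ _ => rfl
  have hnot : ¬ Function.Injective L := by
    intro hinj
    have hle := LinearMap.finrank_le_finrank_of_injective hinj
    have hc : Fintype.card {i // i ∉ F} + F.card = Fintype.card α := by
      rw [Fintype.card_subtype_compl]
      simp only [Fintype.card_coe]
      exact Nat.sub_add_cancel (Finset.card_le_univ F)
    have heq : Module.finrank ℝ (α → ℝ)
        = Module.finrank ℝ (({v // v ∈ V} ⊕ {i // i ∉ F}) → ℝ) := by
      apply le_antisymm hle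
      simp only [Module.finrank_fintype_fun_eq_card, Fintype.card_sum, Fintype.card_coe]
      omega
    have hsurj := (LinearMap.injective_iff_surjective_of_finrank_eq_finrank heq).1 hinj
    obtain ⟨y, hy⟩ := hsurj (Sum.elim (fun _ => 1) (fun _ => 0))
    have h1 : ∀ v ∈ V, ∑ i, edgeDiv (l i) (r i) v (y i) = 1 := by
      intro v hv
      rw [← hLinl y ⟨v, hv⟩, hy]; rfl
    have h2 : ∀ i, i ∉ F → y i = 0 := by
      intro i hi
      rw [← hLinr y ⟨i, hi⟩, hy]; rfl
    have h3 : ∑ v ∈ V, ∑ i, edgeDiv (l i) (r i) v (y i) = 0 := by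
      rw [Finset.sum_comm]
      apply Finset.sum_eq_zero
      intro i _
      by_cases hi : i ∈ F
      · simp [edgeDiv, Finset.sum_sub_distrib, lV i hi, rV i hi]
      · simp [edgeDiv, h2 i hi]
    rw [Finset.sum_congr rfl h1] at h3
    have h4 : V.card ≠ 0 := Finset.card_ne_zero_of_mem (lV i0 ((memF i0).2 hi0))
    simp at h3
    simp [h3] at h4
  rw [← LinearMap.ker_eq_bot, Submodule.eq_bot_iff] at hnot
  push Not at hnot
  obtain ⟨y, hy, hy0⟩ := hnot
  rw [LinearMap.mem_ker] at hy
  have hF0 : ∀ i, i ∉ F → y i = 0 := by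
    intro i hi
    rw [← hLinr y ⟨i, hi⟩, hy]; rfl
  refine ⟨y, hy0, fun i hi => hF0 i (by simp [memF, hi]), ?_⟩
  intro v
  by_cases hv : v ∈ V
  · rw [← hLinl y ⟨v, hv⟩, hy]; rfl
  · apply Finset.sum_eq_zero
    intro i _
    by_cases hi : i ∈ F
    · have h1 : l i ≠ v := by rintro rfl; exact hv (lV i hi)
      have h2 : r i ≠ v := by rintro rfl; exact hv (rV i hi)
      simp [edgeDiv, h1, h2]
    · simp [edgeDiv, hF0 i hi]

lemma interval_exists {α : Type} [Fintype α] (l r : α → ℕ) (hlr : ∀ i, l i ≤ r i)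
    (x : α → ℝ) (Z : AddSubgroup ℝ)
    (hx : ∀ p, ∑ i, (if l i ≤ p ∧ p < r i then x i else 0) ∈ Z) (i0 : α) (hi0 : x i0 ∉ Z) :
    ∃ y : α → ℝ, y ≠ 0 ∧ (∀ i, x i ∈ Z → y i = 0) ∧
      ∀ p, ∑ i, (if l i ≤ p ∧ p < r i then y i else 0) = 0 := by
  have key0 : ∀ y : α → ℝ, ∑ i, edgeDiv (l i) (r i) 0 (y i)
      = ∑ i, (if l i ≤ 0 ∧ 0 < r i then y i else 0) := by
    intro y
    apply Finset.sum_congr rfl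
    intro i _
    have := hlr i
    unfold edgeDiv
    split_ifs <;> first | omega | simp
  have keyS : ∀ (y : α → ℝ) p, ∑ i, edgeDiv (l i) (r i) (p+1) (y i)
      = ∑ i, (if l i ≤ p+1 ∧ p+1 < r i then y i else 0)
        - ∑ i, (if l i ≤ p ∧ p < r i then y i else 0) := by
    intro y p
    rw [← Finset.sum_sub_distrib]
    apply Finset.sum_congr rfl
    intro i _
    have := hlr i
    unfold edgeDiv
    split_ifs <;> first | omega | simp
  obtain ⟨y, h0, h1, h2⟩ := circ_exists l r x Z (by
    intro v
    rcases v with _ | p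
    · rw [key0]; exact hx 0
    · rw [keyS]; exact Z.sub_mem (hx _) (hx _)) i0 hi0
  refine ⟨y, h0, h1, ?_⟩
  intro p
  induction p with
  | zero => rw [← key0]; exact h2 0
  | succ p ih => have := keyS y p; rw [h2, ih] at this; linarith

lemma real_interval_exists {α β : Type} [Fintype α] [Fintype β] (Ra Rb : α → ℝ)
    (hR : ∀ i, Ra i ≤ Rb i) (Ba Bb : β → ℝ) (hB : ∀ j, Ba j ≤ Bb j) (S : Finset β)
    (hS : ∀ j ∈ S, ∀ k ∈ S, Bb j < Bb k ↔ Ba j < Ba k)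
    (x : α → ℝ) (Z : AddSubgroup ℝ)
    (hx : ∀ j ∈ S, ∑ i, (if Ra i ≤ Bb j ∧ Ba j ≤ Rb i then x i else 0) ∈ Z)
    (i0 : α) (hi0 : x i0 ∉ Z) :
    ∃ y : α → ℝ, y ≠ 0 ∧ (∀ i, x i ∈ Z → y i = 0) ∧
      ∀ j ∈ S, ∑ i, (if Ra i ≤ Bb j ∧ Ba j ≤ Rb i then y i else 0) = 0 := by
  obtain ⟨k, hk⟩ : ∃ k, (S.image Bb).card = k := ⟨_, rfl⟩
  let e := (S.image Bb).orderEmbOfFin hk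
  have hg : ∀ q, ∃ j ∈ S, Bb j = e q := fun q =>
    Finset.mem_image.1 ((S.image Bb).orderEmbOfFin_mem hk q)
  choose g hgS hge using hg
  have hb : ∀ p q, Bb (g p) < Bb (g q) ↔ p < q := by
    intro p q; rw [hge, hge]; exact e.lt_iff_lt
  have ha : ∀ p q, Ba (g p) < Ba (g q) ↔ p < q := by
    intro p q; rw [← hb]; exact (hS _ (hgS p) _ (hgS q)).symm
  have hsurj : ∀ j ∈ S, ∃ q, Bb (g q) = Bb j ∧ Ba (g q) = Ba j := by
    intro j hj
    have : Bb j ∈ Set.range e := by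
      rw [Finset.range_orderEmbOfFin]; exact Finset.mem_coe.2 (Finset.mem_image_of_mem _ hj)
    obtain ⟨q, hq⟩ := this
    have h1 : Bb (g q) = Bb j := (hge q).trans hq
    refine ⟨q, h1, le_antisymm ?_ ?_⟩
    · by_contra h; push Not at h
      have := (hS _ hj _ (hgS q)).2 h; linarith
    · by_contra h; push Not at h
      have := (hS _ (hgS q) _ hj).2 h; linarith
  let l : α → ℕ := fun i => (Finset.univ.filter (fun q : Fin k => Bb (g q) < Ra i)).card
  let r : α → ℕ := fun i => (Finset.univ.filter (fun q : Fin k => Ba (g q) ≤ Rb i)).card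
  have hlr : ∀ i, l i ≤ r i := by
    intro i
    apply Finset.card_le_card
    intro q hq
    simp only [Finset.mem_filter, Finset.mem_univ, true_and] at hq ⊢
    linarith [hB (g q), hR i]
  have hrk : ∀ i, r i ≤ k := by
    intro i
    exact (Finset.card_le_univ _).trans (by simp)
  have hl : ∀ i (p : Fin k), l i ≤ p ↔ Ra i ≤ Bb (g p) := by
    intro i p
    constructor
    · intro h; by_contra hc; push Not at hc
      have : (Finset.Iic p).card ≤ l i := by
        apply Finset.card_le_card
        intro q hq
        simp only [Finset.mem_filter, Finset.mem_univ, true_and, Finset.mem_Iic] at hq ⊢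
        have := (not_congr (hb p q)).2 (not_lt.2 hq)
        linarith
      rw [Fin.card_Iic] at this
      omega
    · intro h
      rw [← Fin.card_Iio p]
      apply Finset.card_le_card
      intro q hq
      simp only [Finset.mem_filter, Finset.mem_univ, true_and, Finset.mem_Iio] at hq ⊢
      exact (hb q p).1 (by linarith)
  have hr : ∀ i (p : Fin k), p < r i ↔ Ba (g p) ≤ Rb i := by
    intro i p
    constructor
    · intro h; by_contra hc; push Not at hc
      have : r i ≤ (Finset.Iio p).card := by
        apply Finset.card_le_card
        intro q hq
        simp only [Finset.mem_filter, Finset.mem_univ, true_and, Finset.mem_Iio] at hq ⊢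
        exact (ha q p).1 (by linarith)
      rw [Fin.card_Iio] at this
      omega
    · intro h
      have : (Finset.Iic p).card ≤ r i := by
        apply Finset.card_le_card
        intro q hq
        simp only [Finset.mem_filter, Finset.mem_univ, true_and, Finset.mem_Iic] at hq ⊢
        have := (not_congr (ha p q)).2 (not_lt.2 hq)
        linarith
      rw [Fin.card_Iic] at this
      omega
  obtain ⟨y, h0, h1, h2⟩ := interval_exists l r hlr x Z (by
    intro p
    by_cases hp : p < k
    · have := hx (g ⟨p, hp⟩) (hgS _)
      simp only [← hl, ← hr] at this
      exact this
    · rw [Finset.sum_eq_zero]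
      · exact Z.zero_mem
      · intro i _
        have := hrk i
        rw [if_neg]; omega) i0 hi0
  refine ⟨y, h0, h1, ?_⟩
  intro j hj
  obtain ⟨q, hq1, hq2⟩ := hsurj j hj
  have := h2 q
  simp only [hl, hr, hq1, hq2] at this
  exact this

/-- integrality of the MWDS LP for intervals: every extreme point of the
polytope `P = {x ∈ [0,1]^N : ∑_{i : R_i ∩ B_j ≠ ∅} x_i ≥ 1 for all j}`, where the
`R_i = [Ra_i, Rb_i]` and `B_j = [Ba_j, Bb_j]` are nonempty closed intervals in `ℝ`,
has all coordinates in `{0, 1}`. -/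
theorem mwds_lp_integral_for_intervals (N M : ℕ) (hN : 1 ≤ N) (hM : 1 ≤ M)
    (Ra Rb : Fin N → ℝ) (hR : ∀ i, Ra i ≤ Rb i)
    (Ba Bb : Fin M → ℝ) (hB : ∀ j, Ba j ≤ Bb j)
    (P : Set (Fin N → ℝ))
    (hP : P = {x | (∀ i, 0 ≤ x i ∧ x i ≤ 1) ∧
      ∀ j, 1 ≤ ∑ i ∈ Finset.univ.filter
        (fun i => (Set.Icc (Ra i) (Rb i) ∩ Set.Icc (Ba j) (Bb j)).Nonempty), x i}) :
    ∀ x ∈ Set.extremePoints ℝ P, ∀ i, x i = 0 ∨ x i = 1 := by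
  intro x hxe
  have hxP := hxe.1
  have hmeet : ∀ i j, (Set.Icc (Ra i) (Rb i) ∩ Set.Icc (Ba j) (Bb j)).Nonempty ↔
      (Ra i ≤ Bb j ∧ Ba j ≤ Rb i) := by
    intro i j
    constructor
    · rintro ⟨t, ⟨h1, h2⟩, h3, h4⟩
      exact ⟨h1.trans h4, h3.trans h2⟩
    · rintro ⟨h1, h2⟩
      exact ⟨max (Ra i) (Ba j), ⟨le_max_left _ _, max_le (hR i) h2⟩,
        le_max_right _ _, max_le h1 (hB j)⟩
  have memP : ∀ z, z ∈ P ↔ (∀ i, 0 ≤ z i ∧ z i ≤ 1) ∧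
      ∀ j, 1 ≤ ∑ i, (if Ra i ≤ Bb j ∧ Ba j ≤ Rb i then z i else 0) := by
    intro z
    rw [hP]
    simp only [Set.mem_ofPred_eq, hmeet, Finset.sum_filter]
  obtain ⟨hx01, hxrow⟩ := (memP x).1 hxP
  let Z : AddSubgroup ℝ := (Int.castAddHom ℝ).range
  by_contra hcon
  push Not at hcon
  obtain ⟨i0, hi00, hi01⟩ := hcon
  have hZ : ∀ i, x i ∉ Z ↔ 0 < x i ∧ x i < 1 := by
    intro i
    constructor
    · intro h
      refine ⟨lt_of_le_of_ne (hx01 i).1 ?_, lt_of_le_of_ne (hx01 i).2 ?_⟩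
      · intro h'; exact h ⟨0, by simpa using h'⟩
      · intro h'; exact h ⟨1, by simpa using h'.symm⟩
    · rintro ⟨h1, h2⟩ ⟨n, hn⟩
      simp only [Int.coe_castAddHom] at hn
      rw [← hn] at h1 h2
      have h1' : 0 < n := by exact_mod_cast h1
      have h2' : n < 1 := by exact_mod_cast h2
      omega
  have hi0 : x i0 ∉ Z := (hZ i0).2
    ⟨lt_of_le_of_ne (hx01 i0).1 (Ne.symm hi00), lt_of_le_of_ne (hx01 i0).2 hi01⟩
  let T : Finset (Fin M) := Finset.univ.filter
    (fun j => ∑ i, (if Ra i ≤ Bb j ∧ Ba j ≤ Rb i then x i else 0) = 1)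
  have memT : ∀ j, j ∈ T ↔ ∑ i, (if Ra i ≤ Bb j ∧ Ba j ≤ Rb i then x i else 0) = 1 :=
    fun j => by simp [T]
  let S : Finset (Fin M) := T.filter (fun j => ∀ k ∈ T, Ba j ≤ Ba k → Bb k ≤ Bb j →
    (Ba k = Ba j ∧ Bb k = Bb j))
  have hS : ∀ j ∈ S, ∀ k ∈ S, Bb j < Bb k ↔ Ba j < Ba k := by
    intro j hj k hk
    obtain ⟨hjT, hj⟩ := Finset.mem_filter.1 hj
    obtain ⟨hkT, hk⟩ := Finset.mem_filter.1 hk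
    constructor
    · intro h; by_contra hc; push Not at hc
      have := (hk j hjT hc h.le).2; linarith
    · intro h; by_contra hc; push Not at hc
      have := (hj k hkT h.le hc).1; linarith
  obtain ⟨y, hy0, hyZ, hyS⟩ := real_interval_exists Ra Rb hR Ba Bb hB S hS x Z (by
    intro j hj
    rw [(memT j).1 (Finset.mem_filter.1 hj).1]
    exact ⟨1, by simp⟩) i0 hi0
  have hyT : ∀ j ∈ T, ∑ i, (if Ra i ≤ Bb j ∧ Ba j ≤ Rb i then y i else 0) = 0 := by
    intro j hj
    obtain ⟨k, hk, hkmin⟩ := Finset.exists_min_image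
      (T.filter (fun k => Ba j ≤ Ba k ∧ Bb k ≤ Bb j)) (fun k => Bb k - Ba k)
      ⟨j, Finset.mem_filter.2 ⟨hj, le_rfl, le_rfl⟩⟩
    obtain ⟨hkT, hka, hkb⟩ := Finset.mem_filter.1 hk
    have hkS : k ∈ S := by
      refine Finset.mem_filter.2 ⟨hkT, ?_⟩
      intro m hm h1 h2
      have := hkmin m (Finset.mem_filter.2 ⟨hm, hka.trans h1, h2.trans hkb⟩)
      constructor <;> linarith
    refine Eq.trans ?_ (hyS k hkS)
    have hle : ∀ i ∈ Finset.univ, (if Ra i ≤ Bb k ∧ Ba k ≤ Rb i then x i else 0) ≤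
        (if Ra i ≤ Bb j ∧ Ba j ≤ Rb i then x i else 0) := by
      intro i _
      by_cases h : Ra i ≤ Bb k ∧ Ba k ≤ Rb i
      · rw [if_pos h, if_pos ⟨h.1.trans hkb, hka.trans h.2⟩]
      · rw [if_neg h]; split_ifs
        · exact (hx01 i).1
        · exact le_rfl
    have heq := (Finset.sum_eq_sum_iff_of_le hle).1 (((memT k).1 hkT).trans ((memT j).1 hj).symm)
    apply Finset.sum_congr rfl
    intro i hi
    have hi := heq i hi
    by_cases h : Ra i ≤ Bb k ∧ Ba k ≤ Rb i
    · rw [if_pos h, if_pos ⟨h.1.trans hkb, hka.trans h.2⟩]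
    · by_cases h' : Ra i ≤ Bb j ∧ Ba j ≤ Rb i
      · rw [if_neg h, if_pos h'] at hi ⊢
        exact hyZ i ⟨0, by simpa using hi⟩
      · rw [if_neg h, if_neg h']
  have hsum : ∀ (ε : ℝ) j, ∑ i, (if Ra i ≤ Bb j ∧ Ba j ≤ Rb i then (x + ε • y) i else 0) =
      ∑ i, (if Ra i ≤ Bb j ∧ Ba j ≤ Rb i then x i else 0) +
      ε * ∑ i, (if Ra i ≤ Bb j ∧ Ba j ≤ Rb i then y i else 0) := by
    intro ε j
    rw [Finset.mul_sum, ← Finset.sum_add_distrib]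
    apply Finset.sum_congr rfl
    intro i _
    split_ifs <;> simp
  have hev : ∀ᶠ ε : ℝ in nhds 0, x + ε • y ∈ P := by
    simp only [memP, hsum]
    refine Filter.Eventually.and (Filter.eventually_all.2 ?_) (Filter.eventually_all.2 ?_)
    · intro i
      by_cases hi : x i ∈ Z
      · exact Filter.Eventually.of_forall (fun ε => by simpa [hyZ i hi] using hx01 i)
      · obtain ⟨h1, h2⟩ := (hZ i).1 hi
        have hc : Filter.Tendsto (fun ε : ℝ => (x + ε • y) i) (nhds 0) (nhds (x i)) := by
          have : Continuous (fun ε : ℝ => (x + ε • y) i) := by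
            simp only [Pi.add_apply, Pi.smul_apply, smul_eq_mul]; fun_prop
          simpa using this.tendsto 0
        filter_upwards [hc.eventually_const_lt h1, hc.eventually_lt_const h2] with ε ha hb
        exact ⟨ha.le, hb.le⟩
    · intro j
      by_cases hj : j ∈ T
      · rw [hyT j hj]
        exact Filter.Eventually.of_forall (fun ε => by simpa using hxrow j)
      · have h1 := lt_of_le_of_ne (hxrow j) (fun h => hj ((memT j).2 h.symm))
        generalize ∑ i, (if Ra i ≤ Bb j ∧ Ba j ≤ Rb i then x i else 0) = A at h1
        generalize ∑ i, (if Ra i ≤ Bb j ∧ Ba j ≤ Rb i then y i else 0) = C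
        have hc : Filter.Tendsto (fun ε : ℝ => A + ε * C) (nhds 0) (nhds A) := by
          have : Continuous (fun ε : ℝ => A + ε * C) := by fun_prop
          simpa using this.tendsto 0
        filter_upwards [hc.eventually_const_lt h1] with ε ha
        exact ha.le
  have hneg : ∀ᶠ ε : ℝ in nhds 0, x + (-ε) • y ∈ P := by
    have : Filter.Tendsto (fun ε : ℝ => -ε) (nhds 0) (nhds 0) := by
      simpa using (continuous_neg (G := ℝ)).tendsto 0
    exact this.eventually hev
  obtain ⟨ε, ⟨h1, h2⟩, hε⟩ := (((hev.and hneg).filter_mono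
    (nhdsWithin_le_nhds (s := {0}ᶜ))).and self_mem_nhdsWithin).exists
  have hε : ε ≠ 0 := hε
  have hseg : x ∈ openSegment ℝ (x + ε • y) (x + (-ε) • y) := by
    refine ⟨1/2, 1/2, by norm_num, by norm_num, by norm_num, ?_⟩
    ext i
    simp
    ring
  have := hxe.2 h1 h2 hseg
  apply hy0
  have h3 : ε • y = 0 := by simpa using this
  exact (smul_eq_zero.1 h3).resolve_left hε
end

section
/- Let t, N, M ≥ 1 be integers, let R_1, …, R_N be red t_R-objects and B_1, …, B_M be blue t-objects over a set α, with B_j = b_j^1 ∪ … ∪ b_j^t. Suppose x ∈ [0,1]^N satisfies ∑_{i : R_i ∩ B_j ≠ ∅} x_i ≥ 1 for every j. Then for every j there exists s ∈ {1, …, t} with ∑_{i : R_i ∩ b_j^s ≠ ∅} x_i ≥ 1/t, and for any such choice b'_j = b_j^s the solution x'' defined by x''_i = min(t · x_i, 1) satisfies ∑_{i : R_i ∩ b'_j ≠ ∅} x''_i ≥ 1 for every j. -/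
open scoped Classical

/-- if `x ∈ [0,1]^N` is feasible for the instance with arbitrary red sets
`R_i` and blue `t`-objects `B_j = b_j^1 ∪ … ∪ b_j^t`, then every blue object has a
constituent with fractional coverage at least `1/t`, and for any such choice of
constituents the scaled solution `x''_i = min(t·x_i, 1)` covers each chosen constituent
to extent at least `1`. -/
theorem selection_and_scaling {α : Type*} (t N M : ℕ) (ht : 1 ≤ t) (hN : 1 ≤ N)
    (hM : 1 ≤ M)
    (R : Fin N → Set α)
    (b : Fin M → Fin t → Set α) (B : Fin M → Set α) (hB : ∀ j, B j = ⋃ s, b j s)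
    (x : Fin N → ℝ) (hx : ∀ i, 0 ≤ x i ∧ x i ≤ 1)
    (hfeas : ∀ j, 1 ≤ ∑ i ∈ Finset.univ.filter (fun i => (R i ∩ B j).Nonempty), x i) :
    (∀ j, ∃ s : Fin t,
        (1 : ℝ) / t ≤ ∑ i ∈ Finset.univ.filter (fun i => (R i ∩ b j s).Nonempty), x i) ∧
      ∀ c : Fin M → Fin t,
        (∀ j, (1 : ℝ) / t ≤
            ∑ i ∈ Finset.univ.filter (fun i => (R i ∩ b j (c j)).Nonempty), x i) →
        ∀ j, 1 ≤ ∑ i ∈ Finset.univ.filter (fun i => (R i ∩ b j (c j)).Nonempty),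
            min ((t : ℝ) * x i) 1 := by
  have ht0 : (0 : ℝ) < t := by exact_mod_cast ht
  refine ⟨fun j => ?_, fun c hc j => ?_⟩
  · by_contra! hcon
    have h1 : ∑ i ∈ Finset.univ.filter (fun i => (R i ∩ B j).Nonempty), x i ≤
        ∑ s : Fin t, ∑ i ∈ Finset.univ.filter (fun i => (R i ∩ b j s).Nonempty), x i := by
      simp only [Finset.sum_filter]
      rw [Finset.sum_comm]
      refine Finset.sum_le_sum fun i _ => ?_
      have hnn : ∀ s ∈ (Finset.univ : Finset (Fin t)),
          0 ≤ (if (R i ∩ b j s).Nonempty then x i else 0) := by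
        intro s _
        split_ifs
        · exact (hx i).1
        · exact le_rfl
      split_ifs with h
      · obtain ⟨a, haR, haB⟩ := h
        rw [hB j] at haB
        obtain ⟨s, hs⟩ := Set.mem_iUnion.1 haB
        have h2 := Finset.single_le_sum hnn (Finset.mem_univ s)
        have h3 : (R i ∩ b j s).Nonempty := ⟨a, haR, hs⟩
        rwa [if_pos h3] at h2
      · exact Finset.sum_nonneg hnn
    have h2 : ∑ s : Fin t, ∑ i ∈ Finset.univ.filter (fun i => (R i ∩ b j s).Nonempty), x i
        < ∑ _s : Fin t, (1 : ℝ) / t :=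
      Finset.sum_lt_sum_of_nonempty ⟨⟨0, ht⟩, Finset.mem_univ _⟩ fun s _ => hcon s
    have h3 : ∑ _s : Fin t, (1 : ℝ) / t = 1 := by
      simp [ht0.ne']
    have := hfeas j
    linarith
  · by_cases h : ∃ i ∈ Finset.univ.filter (fun i => (R i ∩ b j (c j)).Nonempty),
        1 ≤ (t : ℝ) * x i
    · obtain ⟨i, hi, h1⟩ := h
      have h2 := Finset.single_le_sum (f := fun i => min ((t : ℝ) * x i) 1)
        (fun k _ => le_min (mul_nonneg ht0.le (hx k).1) zero_le_one) hi
      simpa [min_eq_right h1] using h2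
    · push Not at h
      rw [Finset.sum_congr rfl fun i hi => min_eq_left (h i hi).le, ← Finset.mul_sum]
      have := hc j
      rw [div_le_iff₀ ht0] at this
      linarith
end
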